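/- Fix n, k ≤ n, and positive degrees d_0, d_1,…,d_k. There exists a real polynomial 𝒟 in the coefficients of tuples (p_0, p_1,…,p_k) with p_i ∈ ℝ[x]_{d_i}, where 𝒟 is not the identically zero polynomial, such that whenever 𝒟(p_0,…,p_k) ≠ 0, the KKT system ∇p_0(x) − Σ_{i=1}^k λ_i ∇p_i(x) = 0, p_1(x) = ⋯ = p_k(x) = 0 is nonsingular: for every solution (x, λ) ∈ ℂⁿ × ℂᵏ of this system, the (n+k)×(n+k) matrix H_p(x,λ) = [[∇²L_p(x,λ), J(x)ᵀ],[J(x), 0]] is nonsingular, where L_p(x,λ) = p_0(x) − Σ_i λ_i p_i(x) and J(x) is the k×n Jacobian matrix of (p_1,…,p_k) at x. -/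

import Mathlib

open MvPolynomial Matrix
open scoped Matrix

noncomputable section

/-- Evaluation of a polynomial `𝒟` in the coefficients of the tuple `(p₀, p₁, …, p_k)`. -/
def evalCoeffs {n k : ℕ}
    (D : MvPolynomial ((Unit ⊕ Fin k) × (Fin n →₀ ℕ)) ℝ)
    (p0 : MvPolynomial (Fin n) ℝ) (p : Fin k → MvPolynomial (Fin n) ℝ) : ℝ :=
  eval (fun v => coeff v.2 (Sum.elim (fun _ : Unit => p0) p v.1)) D

/-- Derivations extend along formally étale algebras. -/
theorem Derivation.exists_extension_of_formallyEtale (k S L : Type*) [CommRing k] [CommRing S]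
    [CommRing L] [Algebra k S] [Algebra S L] [Algebra k L] [IsScalarTower k S L]
    [Algebra.FormallyEtale S L] (d : Derivation k S L) :
    ∃ Δ : Derivation k L L, ∀ s, Δ (algebraMap S L s) = d s := by
  refine ⟨LinearMap.compDer
    ((d.liftKaehlerDifferential.liftBaseChange L) ∘ₗ
      (KaehlerDifferential.tensorKaehlerEquivOfFormallyEtale k S L).symm.toLinearMap)
    (KaehlerDifferential.D k L), fun s => ?_⟩
  simp [KaehlerDifferential.tensorKaehlerEquivOfFormallyEtale_symm_D_algebraMap]

/-- The chain rule for a derivation applied to a value of a polynomial. -/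
theorem Derivation.apply_aeval_mvPolynomial {ι k L : Type*} [Fintype ι] [CommRing k] [CommRing L]
    [Algebra k L] (Δ : Derivation k L L) (g : ι → L) (f : MvPolynomial ι k) :
    Δ (aeval g f) = ∑ v, aeval g (pderiv v f) * Δ (g v) := by
  classical
  induction f using MvPolynomial.induction_on with
  | C a => simp
  | add p q hp hq => simp [hp, hq, add_mul, Finset.sum_add_distrib]
  | mul_X p v hp =>
    simp only [map_mul, aeval_X, Derivation.leibniz, hp, pderiv_X, smul_eq_mul, map_add,
      add_mul, Finset.sum_add_distrib, Finset.mul_sum]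
    congr 1
    · rw [Finset.sum_eq_single v] <;> simp +contextual [eq_comm]
    · exact Finset.sum_congr rfl fun i _ => by ring

/-- If each `F j` depends on the parameter `e j` by translation, the Jacobian determinant cannot
vanish at a common zero which is formally étale over the parameter space. -/
theorem det_aeval_pderiv_ne_zero_of_formallyEtale {σ τ k L : Type*} [Fintype σ] [DecidableEq σ]
    [Fintype τ] [CommRing k] [CommRing L] [Nontrivial L] [Algebra k L]
    [Algebra (MvPolynomial τ k) L]
    [IsScalarTower k (MvPolynomial τ k) L] [Algebra.FormallyEtale (MvPolynomial τ k) L]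
    (F : σ → MvPolynomial (σ ⊕ τ) k) (e : σ → τ)
    (hF : ∀ i j, pderiv (Sum.inr (e i)) (F j) = if i = j then 1 else 0)
    (g : σ ⊕ τ → L) (hg : ∀ t, g (Sum.inr t) = algebraMap (MvPolynomial τ k) L (X t))
    (hzero : ∀ j, aeval g (F j) = 0) :
    aeval g (Matrix.det (Matrix.of fun i j => pderiv (Sum.inl j) (F i))) ≠ 0 := by
  classical
  have hext (i : σ) := Derivation.exists_extension_of_formallyEtale k (MvPolynomial τ k) L
    (mkDerivation k (Pi.single (e i) 1))
  choose Δ hΔ using hext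
  have hmul : (Matrix.of fun i j => aeval g (pderiv (Sum.inl j) (F i))) *
      (Matrix.of fun j i => -Δ i (g (Sum.inl j))) = 1 := by
    ext j i
    have h := (Δ i).apply_aeval_mvPolynomial g (F j)
    have hs : ∑ t, aeval g (pderiv (Sum.inr t) (F j)) * Δ i (g (Sum.inr t)) =
        if i = j then 1 else 0 := by
      rw [Finset.sum_eq_single (e i)]
      · rw [hF, hg, hΔ, mkDerivation_X]
        split_ifs <;> simp
      · intro t _ ht
        rw [hg, hΔ, mkDerivation_X, Pi.single_eq_of_ne ht, mul_zero]
      · simp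
    rw [hzero, map_zero, Fintype.sum_sum_type, hs] at h
    simp only [Matrix.mul_apply, Matrix.of_apply, mul_neg, Finset.sum_neg_distrib, Matrix.one_apply,
      eq_comm (a := j)]
    linear_combination h
  have hdet := congrArg Matrix.det hmul
  rw [Matrix.det_mul, Matrix.det_one] at hdet
  rw [AlgHom.map_det]
  exact left_ne_zero_of_mul_eq_one hdet

/-- An ideal of polynomials over a domain `S` of characteristic zero which contains no nonzero
constant has a zero in a field which is formally étale over `S`. -/
theorem exists_formallyEtale_field_aeval_eq_zero {σ S : Type*} [Finite σ] [CommRing S] [IsDomain S]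
    [CharZero S] (J : Ideal (MvPolynomial σ S)) (hJ : ∀ s : S, C s ∈ J → s = 0) :
    ∃ (m : Ideal (MvPolynomial σ (FractionRing S))) (_ : m.IsMaximal),
      Algebra.FormallyEtale S (MvPolynomial σ (FractionRing S) ⧸ m) ∧
      ∃ z : σ → MvPolynomial σ (FractionRing S) ⧸ m, ∀ f ∈ J, aeval z f = 0 := by
  let : Algebra (MvPolynomial σ S) (MvPolynomial σ (FractionRing S)) := algebraMvPolynomial
  have htop : J.map (algebraMap (MvPolynomial σ S) (MvPolynomial σ (FractionRing S))) ≠ ⊤ := by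
    rw [IsLocalization.map_algebraMap_ne_top_iff_disjoint
      ((nonZeroDivisors S).map (C (σ := σ))), Set.disjoint_left]
    rintro _ ⟨s, hs, rfl⟩ hsJ
    exact nonZeroDivisors.ne_zero hs (hJ s hsJ)
  obtain ⟨m, hm, hle⟩ := Ideal.exists_le_maximal _ htop
  refine ⟨m, hm, ?_, fun i => Ideal.Quotient.mk m (X i), fun f hf => ?_⟩
  · let L := MvPolynomial σ (FractionRing S) ⧸ m
    let K := FractionRing S
    let : Field L := Ideal.Quotient.field m
    have : Module.Finite K L := finite_of_finite_type_of_isJacobsonRing K L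
    have : CharZero K := charZero_of_injective_algebraMap (IsFractionRing.injective S K)
    have : Algebra.FormallyEtale K L := Algebra.FormallyEtale.of_isSeparable K L
    have : Algebra.FormallyEtale S K := Algebra.FormallyEtale.of_isLocalization (nonZeroDivisors S)
    exact Algebra.FormallyEtale.comp S K L
  · have haeval : aeval (fun i => Ideal.Quotient.mk m (X i)) f =
        Ideal.Quotient.mk m (map (algebraMap S (FractionRing S)) f) := by
      clear hf
      induction f using MvPolynomial.induction_on with
      | C a => rw [aeval_C, map_C]; rfl
      | add p q hp hq => simp only [map_add, hp, hq]
      | mul_X p v hp => simp only [map_mul, aeval_X, map_X, hp]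
    rw [haeval]
    exact Ideal.Quotient.eq_zero_iff_mem.mpr (hle (Ideal.mem_map_of_mem _ hf))

/-- Algebraic form of Sard's theorem for a polynomial system which can be translated by its
parameters: an equation in the parameters alone lies in the ideal of degenerate zeros. -/
theorem exists_rename_inr_mem_span {σ τ k : Type*} [Fintype σ] [DecidableEq σ]
    [Fintype τ] [Field k] [CharZero k]
    (F : σ → MvPolynomial (σ ⊕ τ) k) (e : σ → τ)
    (hF : ∀ i j, pderiv (Sum.inr (e i)) (F j) = if i = j then 1 else 0) :
    ∃ D : MvPolynomial τ k, D ≠ 0 ∧ rename Sum.inr D ∈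
      Ideal.span (insert (Matrix.det (Matrix.of fun i j => pderiv (Sum.inl j) (F i)))
        (Set.range F)) := by
  set J := Ideal.span (insert (Matrix.det (Matrix.of fun i j => pderiv (Sum.inl j) (F i)))
        (Set.range F)) with hJ
  by_contra! hcon
  obtain ⟨m, hm, hL, z, hz⟩ := exists_formallyEtale_field_aeval_eq_zero
    (J.comap (sumAlgEquiv k σ τ).symm) (by
      intro s hs
      by_contra hne
      refine hcon s hne ?_
      have hrename : rename Sum.inr s = (sumAlgEquiv k σ τ).symm (C s) :=
        (AlgEquiv.eq_symm_apply _).mpr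
          (AlgHom.congr_fun (sumAlgEquiv_comp_rename_inr k σ τ) s)
      rw [hrename]
      exact hs)
  let g : σ ⊕ τ → MvPolynomial σ (FractionRing (MvPolynomial τ k)) ⧸ m :=
    Sum.elim z fun t => algebraMap (MvPolynomial τ k) _ (X t)
  have hg (f : MvPolynomial (σ ⊕ τ) k) : aeval g f = aeval z (sumAlgEquiv k σ τ f) := by
    have h : aeval g = ((aeval z).restrictScalars k).comp (sumAlgEquiv k σ τ).toAlgHom := by
      ext v
      cases v <;> simp [g]
    exact AlgHom.congr_fun h f
  have hker : ∀ f ∈ J, aeval g f = 0 := fun f hf => by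
    rw [hg]
    exact hz _ (by simpa using hf)
  have := hm.isPrime
  exact det_aeval_pderiv_ne_zero_of_formallyEtale F e hF g (fun _ => rfl)
    (fun j => hker _ (Ideal.subset_span (by simp))) (hker _ (Ideal.subset_span (by simp)))

/-- The result of applying a linear operator `T` to the generic polynomial `p_a` with monomials in
`s a`; the variables on the right are its coefficients. -/
def genericApply {α σ κ : Type*} (s : α → Finset (σ →₀ ℕ)) (a : α)
    (T : MvPolynomial σ ℝ →ₗ[ℝ] MvPolynomial σ ℝ) :
    MvPolynomial ((σ ⊕ κ) ⊕ (Σ a, s a)) ℝ :=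
  ∑ m : s a, X (Sum.inr ⟨a, m⟩) * rename (Sum.inl ∘ Sum.inl) (T (monomial m.1 1))

section genericApply

variable {α σ κ : Type*} (s : α → Finset (σ →₀ ℕ)) (a : α)
  (T : MvPolynomial σ ℝ →ₗ[ℝ] MvPolynomial σ ℝ)

theorem pderiv_rename_eq_zero {σ τ R : Type*} [CommSemiring R] {f : σ → τ} {i : τ}
    (hi : i ∉ Set.range f) (p : MvPolynomial σ R) : pderiv i (rename f p) = 0 := by
  classical
  refine pderiv_eq_zero_of_notMem_vars fun h => hi ?_
  obtain ⟨j, _, rfl⟩ := Finset.mem_image.mp (vars_rename f p h)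
  exact ⟨j, rfl⟩

theorem pderiv_inl_inl_genericApply (i : σ) :
    pderiv (Sum.inl (Sum.inl i)) (genericApply (κ := κ) s a T) =
      genericApply s a ((pderiv i).toLinearMap ∘ₗ T) := by
  have hinj : Function.Injective (Sum.inl ∘ Sum.inl : σ → (σ ⊕ κ) ⊕ (Σ a, s a)) :=
    Sum.inl_injective.comp Sum.inl_injective
  have h (q : MvPolynomial σ ℝ) := pderiv_rename hinj i q
  simp only [Function.comp_apply] at h
  simp [genericApply, Derivation.leibniz, h, pderiv_X_of_ne]

theorem pderiv_inl_inr_genericApply (b : κ) :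
    pderiv (Sum.inl (Sum.inr b)) (genericApply (κ := κ) s a T) = 0 := by
  simp [genericApply, Derivation.leibniz, pderiv_rename_eq_zero, pderiv_X_of_ne]

theorem pderiv_inr_genericApply_self (m : s a) :
    pderiv (Sum.inr ⟨a, m⟩) (genericApply (κ := κ) s a T) =
      rename (Sum.inl ∘ Sum.inl) (T (monomial m.1 1)) := by
  classical
  simp only [genericApply, map_sum, Derivation.leibniz]
  rw [Finset.sum_eq_single m]
  · simp [pderiv_rename_eq_zero]
  · intro m' _ hm'
    rw [pderiv_rename_eq_zero (by simp), pderiv_X_of_ne (by simpa using hm')]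
    simp
  · simp

theorem pderiv_inr_genericApply_of_ne (t : Σ a, s a) (h : t.1 ≠ a) :
    pderiv (Sum.inr t) (genericApply (κ := κ) s a T) = 0 := by
  refine (map_sum _ _ _).trans (Finset.sum_eq_zero fun m _ => ?_)
  rw [Derivation.leibniz, pderiv_rename_eq_zero (by simp), pderiv_X_of_ne]
  · simp
  · intro h'
    exact h (congrArg Sigma.fst (Sum.inr_injective h')).symm

theorem aeval_genericApply (P : α → MvPolynomial σ ℝ) (hP : (P a).support ⊆ s a)
    (x : σ → ℂ) (y : κ → ℂ) :
    aeval (Sum.elim (Sum.elim x y) fun t : Σ a, s a => ((coeff t.2.1 (P t.1) : ℝ) : ℂ))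
      (genericApply s a T) = aeval x (T (P a)) := by
  have hsum : P a = ∑ m : s a, coeff m.1 (P a) • monomial m.1 (1 : ℝ) := by
    rw [Finset.sum_coe_sort (s a) fun m => coeff m (P a) • monomial m (1 : ℝ)]
    conv_lhs => rw [(P a).as_sum]
    refine (Finset.sum_subset hP fun m _ hm => ?_).trans (Finset.sum_congr rfl fun m _ => ?_)
    · rw [notMem_support_iff.mp hm, monomial_zero]
    · rw [smul_monomial, smul_eq_mul, mul_one]
  conv_rhs => rw [hsum]
  simp only [genericApply, map_sum, map_mul, aeval_X, Sum.elim_inr, aeval_rename, map_smul]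
  refine Finset.sum_congr rfl fun m _ => ?_
  rw [← Function.comp_assoc, Sum.elim_comp_inl, Sum.elim_comp_inl, Complex.real_smul]

end genericApply

/-- The generic KKT system, with the multipliers `λ` replaced by `-λ`. -/
def genericKKT {n k : ℕ} (s : Unit ⊕ Fin k → Finset (Fin n →₀ ℕ)) :
    Fin n ⊕ Fin k → MvPolynomial ((Fin n ⊕ Fin k) ⊕ (Σ a, s a)) ℝ :=
  Sum.elim
    (fun j => genericApply s (Sum.inl ()) (pderiv j).toLinearMap +
      ∑ b, X (Sum.inl (Sum.inr b)) * genericApply s (Sum.inr b) (pderiv j).toLinearMap)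
    (fun b => genericApply s (Sum.inr b) LinearMap.id)

theorem pderiv_inr_genericKKT {n k : ℕ} (s : Unit ⊕ Fin k → Finset (Fin n →₀ ℕ))
    (h0 : ∀ j, Finsupp.single j 1 ∈ s (Sum.inl ())) (h1 : ∀ b, 0 ∈ s (Sum.inr b))
    (i j : Fin n ⊕ Fin k) :
    pderiv (Sum.inr (Sum.elim (fun j => (⟨Sum.inl (), ⟨_, h0 j⟩⟩ : Σ a, s a))
      (fun b => ⟨Sum.inr b, ⟨0, h1 b⟩⟩) i)) (genericKKT s j) = if i = j then 1 else 0 := by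
  classical
  rcases i with i | b <;> rcases j with j | b'
  · simp only [genericKKT, Sum.elim_inl, map_add, map_sum, Derivation.leibniz,
      pderiv_inr_genericApply_self]
    rw [Finset.sum_eq_zero fun b _ => by
      rw [pderiv_inr_genericApply_of_ne _ _ _ _ (by simp), pderiv_X_of_ne (by simp)]; simp]
    change rename _ (pderiv j (X i)) + 0 = _
    rw [pderiv_X]
    by_cases h : i = j <;> simp [h]
  · simp [genericKKT, pderiv_inr_genericApply_of_ne]
  · simp only [genericKKT, Sum.elim_inl, Sum.elim_inr, map_add, map_sum, Derivation.leibniz]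
    rw [pderiv_inr_genericApply_of_ne _ _ _ _ (by simp), Finset.sum_eq_zero]
    · simp
    · intro b' _
      rw [pderiv_X_of_ne (by simp), smul_zero, add_zero]
      by_cases h : b = b'
      · subst h
        rw [pderiv_inr_genericApply_self]
        change _ • rename _ (pderiv j (C 1)) = 0
        simp
      · rw [pderiv_inr_genericApply_of_ne _ _ _ _ (by simpa using h), smul_zero]
  · simp only [genericKKT, Sum.elim_inr]
    by_cases h : b = b'
    · subst h
      rw [pderiv_inr_genericApply_self]
      change rename _ (C 1) = _
      simp
    · rw [pderiv_inr_genericApply_of_ne _ _ _ _ (by simpa using h)]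
      simp [h]

/-- A nonzero polynomial in the coefficients of polynomials with prescribed finite sets of
monomials does not vanish at some tuple of such polynomials. -/
theorem exists_eval_coeff_ne_zero {α σ : Type*} (s : α → Finset (σ →₀ ℕ))
    (D : MvPolynomial (Σ a, s a) ℝ) (hD : D ≠ 0) :
    ∃ P : α → MvPolynomial σ ℝ, (∀ a, (P a).support ⊆ s a) ∧
      eval (fun t => coeff t.2.1 (P t.1)) D ≠ 0 := by
  classical
  obtain ⟨c, hc⟩ : ∃ c, eval c D ≠ 0 := by
    by_contra! h
    exact hD (MvPolynomial.funext fun c => by simpa using h c)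
  refine ⟨fun a => ∑ m : s a, monomial m.1 (c ⟨a, m⟩), fun a => ?_, ?_⟩
  · refine support_sum.trans (Finset.biUnion_subset.mpr fun m _ => ?_)
    exact support_monomial_subset.trans (Finset.singleton_subset_iff.mpr m.2)
  · have hcoeff : (fun t : Σ a, s a =>
        coeff t.2.1 (∑ m : s t.1, monomial m.1 (c ⟨t.1, m⟩))) = c := by
      ext ⟨a, m⟩
      simp [coeff_sum, coeff_monomial]
    rwa [hcoeff]

/-- There is a nonzero polynomial `𝒟` in the coefficients of `(p₀, p₁, …, p_k)`
(with the given degree bounds) such that whenever `𝒟(p₀,…,p_k) ≠ 0`, the KKT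
system `∇p₀(x) − Σ λ_i ∇p_i(x) = 0`, `p₁(x) = ⋯ = p_k(x) = 0` is nonsingular:
at every complex solution `(x, λ)`, the bordered Hessian
`H_p(x,λ) = [[∇²L_p(x,λ), J(x)ᵀ],[J(x), 0]]` is nonsingular. -/
theorem generic_kkt_nonsingular
    (n k : ℕ) (hk : k ≤ n)
    (d0 : ℕ) (d : Fin k → ℕ)
    (hd0 : 0 < d0) (hd : ∀ i, 0 < d i) :
    ∃ D : MvPolynomial ((Unit ⊕ Fin k) × (Fin n →₀ ℕ)) ℝ,
      (∃ (p0 : MvPolynomial (Fin n) ℝ) (p : Fin k → MvPolynomial (Fin n) ℝ),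
        p0.totalDegree ≤ d0 ∧ (∀ i, (p i).totalDegree ≤ d i) ∧
        evalCoeffs D p0 p ≠ 0) ∧
      ∀ (p0 : MvPolynomial (Fin n) ℝ) (p : Fin k → MvPolynomial (Fin n) ℝ),
        p0.totalDegree ≤ d0 → (∀ i, (p i).totalDegree ≤ d i) →
        evalCoeffs D p0 p ≠ 0 →
        ∀ (x : Fin n → ℂ) (lam : Fin k → ℂ),
          (∀ i : Fin n, aeval x (pderiv i p0)
              - ∑ a : Fin k, lam a * aeval x (pderiv i (p a)) = 0) →
          (∀ a : Fin k, aeval x (p a) = 0) →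
          (Matrix.fromBlocks
            (Matrix.of fun i j : Fin n =>
              aeval x (pderiv i (pderiv j p0))
                - ∑ a : Fin k, lam a * aeval x (pderiv i (pderiv j (p a))))
            (Matrix.of fun (a : Fin k) (i : Fin n) => aeval x (pderiv i (p a)))ᵀ
            (Matrix.of fun (a : Fin k) (i : Fin n) => aeval x (pderiv i (p a)))
            (0 : Matrix (Fin k) (Fin k) ℂ)).det ≠ 0 := by
  classical
  let δ : Unit ⊕ Fin k → ℕ := Sum.elim (fun _ => d0) d
  let s (a : Unit ⊕ Fin k) : Finset (Fin n →₀ ℕ) :=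
    (Finsupp.finite_of_degree_le (σ := Fin n) (δ a)).toFinset
  have hs {a m} : m ∈ s a ↔ m.degree ≤ δ a := by simp [s]
  have hsupp (q : MvPolynomial (Fin n) ℝ) (a) : q.support ⊆ s a ↔ q.totalDegree ≤ δ a := by
    simp only [Finset.subset_iff, hs]
    exact Finset.sup_le_iff.symm
  obtain ⟨D, hD, hmem⟩ := exists_rename_inr_mem_span (genericKKT s) _
    (pderiv_inr_genericKKT s (fun j => hs.mpr (by simpa [δ] using Nat.one_le_iff_ne_zero.mpr hd0.ne')) (fun b => hs.mpr (by simp)))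
  have heval (p0 : MvPolynomial (Fin n) ℝ) (p : Fin k → MvPolynomial (Fin n) ℝ) :
      evalCoeffs (rename (fun t : Σ a, s a => (t.1, t.2.1)) D) p0 p =
        eval (fun t => coeff t.2.1 (Sum.elim (fun _ : Unit => p0) p t.1)) D := by
    simp only [evalCoeffs, eval_rename]
    rfl
  refine ⟨rename (fun t => (t.1, t.2.1)) D, ?_, ?_⟩
  · obtain ⟨P, hP, hPD⟩ := exists_eval_coeff_ne_zero s D hD
    refine ⟨P (Sum.inl ()), fun b => P (Sum.inr b), (hsupp _ _).mp (hP (Sum.inl ())),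
      fun b => (hsupp _ _).mp (hP (Sum.inr b)), ?_⟩
    rw [heval]
    convert hPD using 5 with t
    rcases t with ⟨_ | _, _⟩ <;> rfl
  · intro p0 p hp0 hp hne x lam hgrad hcon hdet
    let P : Unit ⊕ Fin k → MvPolynomial (Fin n) ℝ := Sum.elim (fun _ => p0) p
    have hP (a) : (P a).support ⊆ s a := (hsupp _ _).mpr <| by
      rcases a with _ | b
      exacts [hp0, hp b]
    let g : (Fin n ⊕ Fin k) ⊕ (Σ a, s a) → ℂ :=
      Sum.elim (Sum.elim x fun b => -lam b) fun t => ((coeff t.2.1 (P t.1) : ℝ) : ℂ)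
    have hg (a T) : aeval g (genericApply s a T) = aeval x (T (P a)) :=
      aeval_genericApply s a T P (hP a) x _
    have hker : ∀ f ∈ Ideal.span (insert (Matrix.det (Matrix.of fun i j =>
        pderiv (Sum.inl j) (genericKKT s i))) (Set.range (genericKKT s))), aeval g f = 0 := by
      intro f hf
      rw [← RingHom.mem_ker]
      refine Ideal.span_le.mpr (Set.insert_subset ?_ ?_) hf
      · rw [SetLike.mem_coe, RingHom.mem_ker, AlgHom.map_det, ← Matrix.det_transpose, ← hdet]
        congr 1
        ext (i | b) (j | b')
        · simp [genericKKT, pderiv_inl_inl_genericApply, hg, P, g, sub_eq_add_neg]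
        · simp [genericKKT, pderiv_inl_inl_genericApply, hg, P]
        · simp [genericKKT, pderiv_inl_inr_genericApply, hg, P, pderiv_X, Pi.single_apply]
        · simp [genericKKT, pderiv_inl_inr_genericApply]
      · rintro _ ⟨j | b, rfl⟩
        · simpa [genericKKT, hg, P, g, sub_eq_add_neg] using hgrad j
        · simpa [genericKKT, hg, P] using hcon b
    refine hne ?_
    have h := hker _ hmem
    rw [aeval_rename] at h
    rw [heval]
    have hreal := aeval_algebraMap_apply ℂ (fun t : Σ a, s a => coeff t.2.1 (P t.1)) D
    exact Complex.ofReal_injective (hreal.symm.trans h)
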